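/- arXiv:1807.05624 — 2 statements merged into one kernel-verified Lean document; each statement's English description precedes it below -/
import Mathlib

section
/- Let E be a nonempty bounded subset of M_a, p ∈ E, and let r > 0 be such that E ⊆ B_r(p), where B_r(p) = {y ∈ M_a : ‖y − p‖_a < r} is the open ball of radius r about p. Then GS(GS(E,p) ∩ B_r(p), p) equals the closure of GS(E,p) in M_a. -/
open Filter

noncomputable section

/-- Fix a sequence `a` of positive reals with `∑ aᵢ² < ∞`.  The space
`M_a` consists of the real sequences `x` with `∑ aᵢ² xᵢ² < ∞`. -/
def Ma (a : ℕ → ℝ) : Set (ℕ → ℝ) := {x | Summable fun i => (a i) ^ 2 * (x i) ^ 2}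

/-- The inner product `⟨x,y⟩_a = ∑ aᵢ² xᵢ yᵢ` on `M_a`. -/
def innerA (a : ℕ → ℝ) (x y : ℕ → ℝ) : ℝ := ∑' i, (a i) ^ 2 * (x i * y i)

/-- The metric `d_a(x,y) = (∑ aᵢ² (xᵢ - yᵢ)²)^{1/2}`. -/
def da (a : ℕ → ℝ) (x y : ℕ → ℝ) : ℝ := Real.sqrt (∑' i, (a i) ^ 2 * (x i - y i) ^ 2)

/-- `eᵢ`: the sequence with `1` in the `i`-th coordinate and `0` elsewhere. -/
def eSeq (i : ℕ) : ℕ → ℝ := Pi.single i 1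

/-- `Λ(E) = {i | ∃ x ∈ E, ∃ α ≠ 0, x + α eᵢ ∈ E}`. -/
def Lam (E : Set (ℕ → ℝ)) : Set ℕ :=
  {i | ∃ x ∈ E, ∃ α : ℝ, α ≠ 0 ∧ x + α • eSeq i ∈ E}

/-- Convergence of the series `∑ᵢ f i` to `s` in `M_a`: the partial sums
converge to `s` with respect to the metric `d_a`. -/
def ConvSeries (a : ℕ → ℝ) (f : ℕ → ℕ → ℝ) (s : ℕ → ℝ) : Prop :=
  Tendsto (fun n => da a (∑ i ∈ Finset.range n, f i) s) atTop (nhds 0)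

/-- The generalized linear span `GS(E,p)`: all points `p + ∑ᵢ αᵢ (xᵢ - p) ∈ M_a`
with `xᵢ ∈ E`, `αᵢ ∈ ℝ`, the series converging in `M_a`. -/
def GS (a : ℕ → ℝ) (E : Set (ℕ → ℝ)) (p : ℕ → ℝ) : Set (ℕ → ℝ) :=
  {u | u ∈ Ma a ∧ ∃ x : ℕ → ℕ → ℝ, ∃ α : ℕ → ℝ,
    (∀ i, x i ∈ E) ∧ ConvSeries a (fun i => α i • (x i - p)) (u - p)}

/-- `E` is a `d_a`-bounded set. -/
def BoundedA (a : ℕ → ℝ) (E : Set (ℕ → ℝ)) : Prop :=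
  ∃ C : ℝ, ∀ x ∈ E, ∀ y ∈ E, da a x y ≤ C

/-- `f` is a `d_a`-isometry on `E`. -/
def IsIsomOn (a : ℕ → ℝ) (f : (ℕ → ℝ) → ℕ → ℝ) (E : Set (ℕ → ℝ)) : Prop :=
  ∀ x ∈ E, ∀ y ∈ E, da a (f x) (f y) = da a x y

/-- Data for a basic cylinder: each factor is a nonempty closed subinterval
`[lo i, hi i] ⊆ [0,1]`, and all but finitely many factors equal `[0,1]`. -/
def IsBCData (lo hi : ℕ → ℝ) : Prop :=
  (∀ i, 0 ≤ lo i) ∧ (∀ i, lo i ≤ hi i) ∧ (∀ i, hi i ≤ 1) ∧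
    {i | ¬(lo i = 0 ∧ hi i = 1)}.Finite

/-- The product set `∏ᵢ [lo i, hi i]`. -/
def cylSet (lo hi : ℕ → ℝ) : Set (ℕ → ℝ) := {x | ∀ i, x i ∈ Set.Icc (lo i) (hi i)}

/-- `J` is a basic cylinder. -/
def IsBasicCylinder (J : Set (ℕ → ℝ)) : Prop :=
  ∃ lo hi : ℕ → ℝ, IsBCData lo hi ∧ J = cylSet lo hi

/-- The elementary volume of a basic cylinder: the product of the lengths of its
edges (a finite product; it is `0` exactly when some factor is a singleton). -/
def bcVol (lo hi : ℕ → ℝ) : ℝ := ∏ᶠ i, (hi i - lo i)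

/-- `K` is a cylinder of volume `v`: there are a basic cylinder of elementary
volume `v` and a surjective `d_a`-isometry from it onto `K`. -/
def IsCylVol (a : ℕ → ℝ) (K : Set (ℕ → ℝ)) (v : ℝ) : Prop :=
  ∃ lo hi : ℕ → ℝ, IsBCData lo hi ∧ v = bcVol lo hi ∧
    ∃ f : (ℕ → ℝ) → ℕ → ℝ, IsIsomOn a f (cylSet lo hi) ∧ f '' cylSet lo hi = K

/-- `K` is a cylinder. -/
def IsCylinder (a : ℕ → ℝ) (K : Set (ℕ → ℝ)) : Prop := ∃ v : ℝ, IsCylVol a K v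

/-- The `d_a`-diameter of a set. -/
def daDiam (a : ℕ → ℝ) (K : Set (ℕ → ℝ)) : ℝ := sSup (Set.image2 (da a) K K)

/-- `μ_δ(E)`: the infimum of `∑ vol(Kᵢ)` over countable coverings of `E` by
cylinders of `d_a`-diameter `< δ` (`∞` if no such covering exists). -/
def preMu (a : ℕ → ℝ) (δ : ℝ) (E : Set (ℕ → ℝ)) : ENNReal :=
  sInf {m : ENNReal | ∃ (K : ℕ → Set (ℕ → ℝ)) (v : ℕ → ℝ),
    (∀ n, IsCylVol a (K n) (v n)) ∧ (∀ n, daDiam a (K n) < δ) ∧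
    (E ⊆ ⋃ n, K n) ∧ m = ∑' n, ENNReal.ofReal (v n)}

/-- The outer measure `μ(E) = lim_{δ→0⁺} μ_δ(E) = sup_{δ>0} μ_δ(E)`. -/
def muA (a : ℕ → ℝ) (E : Set (ℕ → ℝ)) : ENNReal :=
  ⨆ (δ : ℝ) (_ : 0 < δ), preMu a δ E

/-- The Hilbert cube `I^ω = [0,1]^ℕ`, viewed as a subset of `M_a`. -/
def cube : Set (ℕ → ℝ) := {x | ∀ i, x i ∈ Set.Icc (0 : ℝ) 1}

/-- `M_a` as a submodule of the space of all real sequences. -/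
def maSubmodule (a : ℕ → ℝ) : Submodule ℝ (ℕ → ℝ) where
  carrier := Ma a
  zero_mem' := by simp [Ma, summable_zero]
  add_mem' := by
    intro x y hx hy
    refine Summable.of_nonneg_of_le (fun i => by positivity) (fun i => ?_)
      ((hx.add hy).mul_left 2)
    have h : 0 ≤ (a i) ^ 2 * (x i - y i) ^ 2 := by positivity
    simp only [Pi.add_apply]
    nlinarith
  smul_mem' := by
    intro c x hx
    refine (Summable.mul_left (c ^ 2) hx).congr fun i => ?_
    simp only [Pi.smul_apply, smul_eq_mul]
    ring

lemma mem_maSubmodule {a x : ℕ → ℝ} : x ∈ maSubmodule a ↔ x ∈ Ma a := Iff.rfl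

lemma da_eq_da_sub_zero (a x y : ℕ → ℝ) : da a x y = da a (x - y) 0 := by
  simp [da]

lemma da_nonneg (a x y : ℕ → ℝ) : 0 ≤ da a x y := Real.sqrt_nonneg _

lemma da_self (a x : ℕ → ℝ) : da a x x = 0 := by simp [da]

lemma da_comm (a x y : ℕ → ℝ) : da a x y = da a y x := by
  unfold da
  congr 1
  exact tsum_congr fun i => by ring

lemma da_smul_zero (a : ℕ → ℝ) (c : ℝ) (x : ℕ → ℝ) : da a (c • x) 0 = |c| * da a x 0 := by
  have h : ∀ i, (a i) ^ 2 * ((c • x) i - (0 : ℕ → ℝ) i) ^ 2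
      = c ^ 2 * ((a i) ^ 2 * (x i - (0 : ℕ → ℝ) i) ^ 2) := fun i => by
    simp only [Pi.smul_apply, smul_eq_mul, Pi.zero_apply]
    ring
  unfold da
  rw [tsum_congr h, tsum_mul_left, Real.sqrt_mul (sq_nonneg c), Real.sqrt_sq_eq_abs]

lemma da_add_zero_le {a x y : ℕ → ℝ} (hx : x ∈ Ma a) (hy : y ∈ Ma a) :
    da a (x + y) 0 ≤ da a x 0 + da a y 0 := by
  have hsq : ∀ z : ℕ → ℝ, ∀ i, (a i) ^ 2 * (z i) ^ 2 = |a i * z i| ^ (2 : ℝ) := fun z i => by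
    rw [Real.rpow_two, sq_abs, mul_pow]
  have hda : ∀ z : ℕ → ℝ, da a z 0 = (∑' i, |a i * z i| ^ (2 : ℝ)) ^ (1 / (2 : ℝ)) := fun z => by
    rw [← Real.sqrt_eq_rpow]
    unfold da
    congr 1
    exact tsum_congr fun i => by rw [← hsq, Pi.zero_apply, sub_zero]
  have hs : ∀ z ∈ Ma a, Summable fun i => |a i * z i| ^ (2 : ℝ) := fun z hz =>
    Summable.congr hz (hsq z)
  have hxy := hs _ ((maSubmodule a).add_mem hx hy)
  obtain ⟨h₁, h₂⟩ := Real.Lp_add_le_tsum_of_nonneg (p := 2) one_le_two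
    (fun i => abs_nonneg (a i * x i)) (fun i => abs_nonneg (a i * y i)) (hs x hx) (hs y hy)
  rw [hda, hda, hda]
  refine le_trans ?_ h₂
  refine Real.rpow_le_rpow (tsum_nonneg fun i => by positivity) ?_ (by norm_num)
  refine hxy.tsum_le_tsum (fun i => ?_) h₁
  refine Real.rpow_le_rpow (abs_nonneg _) ?_ (by norm_num)
  rw [Pi.add_apply, mul_add]
  exact abs_add_le _ _

lemma da_triangle {a x y z : ℕ → ℝ} (hx : x ∈ Ma a) (hy : y ∈ Ma a) (hz : z ∈ Ma a) :
    da a x z ≤ da a x y + da a y z := by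
  rw [da_eq_da_sub_zero a x z, da_eq_da_sub_zero a x y, da_eq_da_sub_zero a y z,
    ← sub_add_sub_cancel x y z]
  exact da_add_zero_le ((maSubmodule a).sub_mem hx hy) ((maSubmodule a).sub_mem hy hz)

/-- The closure in `M_a` of a linear subspace. -/
def maClosure (a : ℕ → ℝ) (V : Submodule ℝ (ℕ → ℝ)) : Submodule ℝ (ℕ → ℝ) where
  carrier := {v | v ∈ Ma a ∧ ∀ ε > 0, ∃ w ∈ V, w ∈ Ma a ∧ da a v w < ε}
  zero_mem' := ⟨(maSubmodule a).zero_mem, fun ε hε =>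
    ⟨0, V.zero_mem, (maSubmodule a).zero_mem, by rwa [da_self]⟩⟩
  add_mem' := by
    rintro x y ⟨hx, hx'⟩ ⟨hy, hy'⟩
    refine ⟨(maSubmodule a).add_mem hx hy, fun ε hε => ?_⟩
    obtain ⟨v, hv, hva, hvd⟩ := hx' (ε / 2) (half_pos hε)
    obtain ⟨w, hw, hwa, hwd⟩ := hy' (ε / 2) (half_pos hε)
    refine ⟨v + w, V.add_mem hv hw, (maSubmodule a).add_mem hva hwa, ?_⟩
    rw [da_eq_da_sub_zero] at hvd hwd ⊢
    rw [add_sub_add_comm]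
    linarith [da_add_zero_le ((maSubmodule a).sub_mem hx hva) ((maSubmodule a).sub_mem hy hwa)]
  smul_mem' := by
    rintro c x ⟨hx, hx'⟩
    refine ⟨(maSubmodule a).smul_mem c hx, fun ε hε => ?_⟩
    obtain ⟨v, hv, hva, hvd⟩ := hx' (ε / (|c| + 1)) (by positivity)
    refine ⟨c • v, V.smul_mem c hv, (maSubmodule a).smul_mem c hva, ?_⟩
    rw [da_eq_da_sub_zero, ← smul_sub, da_smul_zero, ← da_eq_da_sub_zero]
    rw [lt_div_iff₀ (by positivity)] at hvd
    nlinarith [da_nonneg a x v]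

lemma mem_maClosure {a v : ℕ → ℝ} {V : Submodule ℝ (ℕ → ℝ)} :
    v ∈ maClosure a V ↔ v ∈ Ma a ∧ ∀ ε > 0, ∃ w ∈ V, w ∈ Ma a ∧ da a v w < ε := Iff.rfl

lemma mem_maClosure_of_forall_near {a v : ℕ → ℝ} {V : Submodule ℝ (ℕ → ℝ)} (hv : v ∈ Ma a)
    (h : ∀ ε > 0, ∃ w ∈ maClosure a V, da a v w < ε) : v ∈ maClosure a V := by
  refine ⟨hv, fun ε hε => ?_⟩
  obtain ⟨w, ⟨hwa, hw⟩, hvw⟩ := h (ε / 2) (half_pos hε)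
  obtain ⟨z, hz, hza, hwz⟩ := hw (ε / 2) (half_pos hε)
  exact ⟨z, hz, hza, by linarith [da_triangle hv hwa hza]⟩

lemma sub_mem_maClosure_of_mem_GS {a p u : ℕ → ℝ} {F : Set (ℕ → ℝ)}
    {V : Submodule ℝ (ℕ → ℝ)} (hp : p ∈ Ma a) (hF : ∀ x ∈ F, x - p ∈ maClosure a V)
    (hu : u ∈ GS a F p) : u - p ∈ maClosure a V := by
  obtain ⟨hua, x, α, hx, hconv⟩ := hu
  refine mem_maClosure_of_forall_near ((maSubmodule a).sub_mem hua hp) fun ε hε => ?_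
  obtain ⟨n, hn⟩ := (hconv.eventually_lt_const hε).exists
  exact ⟨_, Submodule.sum_mem _ fun i _ => Submodule.smul_mem _ _ (hF _ (hx i)),
    by rwa [da_comm]⟩

/-- The linear span of the differences `x - p`, `x ∈ E`. -/
def dirSpan (E : Set (ℕ → ℝ)) (p : ℕ → ℝ) : Submodule ℝ (ℕ → ℝ) :=
  Submodule.span ℝ ((fun x => x - p) '' E)

lemma sub_mem_dirSpan {E : Set (ℕ → ℝ)} {p x : ℕ → ℝ} (hx : x ∈ E) : x - p ∈ dirSpan E p :=
  Submodule.subset_span ⟨x, hx, rfl⟩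

lemma dirSpan_le_maSubmodule {a : ℕ → ℝ} {E : Set (ℕ → ℝ)} {p : ℕ → ℝ} (hE : E ⊆ Ma a)
    (hp : p ∈ Ma a) : dirSpan E p ≤ maSubmodule a := by
  refine Submodule.span_le.2 ?_
  rintro _ ⟨x, hx, rfl⟩
  exact (maSubmodule a).sub_mem (hE hx) hp

lemma add_mem_GS_of_mem_dirSpan {a : ℕ → ℝ} {E : Set (ℕ → ℝ)} {p v : ℕ → ℝ} (hE : E ⊆ Ma a)
    (hp : p ∈ E) (hv : v ∈ dirSpan E p) : p + v ∈ GS a E p := by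
  refine ⟨(maSubmodule a).add_mem (hE hp) (dirSpan_le_maSubmodule hE (hE hp) hv), ?_⟩
  obtain ⟨n, f, g, rfl⟩ := Submodule.mem_span_set'.1 hv
  choose y hy hyg using fun i => (g i).2
  refine ⟨fun i => if h : i < n then y ⟨i, h⟩ else p, fun i => if h : i < n then f ⟨i, h⟩ else 0,
    fun i => ?_, ?_⟩
  · dsimp only
    split_ifs
    exacts [hy _, hp]
  · refine tendsto_const_nhds.congr' ?_
    filter_upwards [eventually_ge_atTop n] with N hN
    rw [add_sub_cancel_left, ← Finset.sum_subset (Finset.range_subset_range.2 hN),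
      Finset.sum_range, Finset.sum_congr rfl, da_self]
    · intro i _
      simp [← hyg]
    · intro i _ hi
      simp [Finset.mem_range.not.1 hi]

lemma mem_GS_of_sub_mem_maClosure {a : ℕ → ℝ} {F : Set (ℕ → ℝ)} {p u : ℕ → ℝ}
    {V : Submodule ℝ (ℕ → ℝ)} (hu : u ∈ Ma a)
    (hF : ∀ v ∈ V, ∃ c : ℝ, c ≠ 0 ∧ p + c • v ∈ F) (h : u - p ∈ maClosure a V) :
    u ∈ GS a F p := by
  refine ⟨hu, ?_⟩
  choose w hwV _ hw using fun n : ℕ => h.2 (1 / ((n : ℝ) + 1)) Nat.one_div_pos_of_nat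
  let s : ℕ → ℕ → ℝ := fun n => Nat.casesOn n 0 w
  have hsV : ∀ n, s n ∈ V := by
    rintro (_ | n)
    exacts [V.zero_mem, hwV n]
  choose c hc hcF using fun n => hF (s (n + 1) - s n) (V.sub_mem (hsV (n + 1)) (hsV n))
  refine ⟨fun n => p + c n • (s (n + 1) - s n), fun n => (c n)⁻¹, hcF, ?_⟩
  have hsum : ∀ n, ∑ i ∈ Finset.range n, (c i)⁻¹ • (p + c i • (s (i + 1) - s i) - p) = s n := by
    intro n
    simp_rw [add_sub_cancel_left, inv_smul_smul₀ (hc _)]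
    rw [Finset.sum_range_sub]
    exact sub_zero _
  unfold ConvSeries
  simp_rw [hsum]
  refine (tendsto_add_atTop_iff_nat 1).1 ?_
  refine squeeze_zero (fun n => da_nonneg _ _ _) (fun n => ?_)
    tendsto_one_div_add_atTop_nhds_zero_nat
  rw [da_comm]
  exact (hw n).le

lemma exists_smul_da_lt (a v : ℕ → ℝ) {r : ℝ} (hr : 0 < r) :
    ∃ c : ℝ, c ≠ 0 ∧ da a (c • v) 0 < r := by
  have hv := da_nonneg a v 0
  refine ⟨r / (da a v 0 + 1), by positivity, ?_⟩
  rw [da_smul_zero, abs_of_pos (by positivity), div_mul_eq_mul_div, div_lt_iff₀ (by positivity)]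
  nlinarith

/-- If `E ⊆ B_r(p)`, then `GS(GS(E,p) ∩ B_r(p), p)` equals the closure of
`GS(E,p)` in `M_a`. -/
theorem ulam_stmt8 (a : ℕ → ℝ) (ha : ∀ i, 0 < a i)
    (hsum : Summable fun i => (a i) ^ 2)
    (E : Set (ℕ → ℝ)) (hne : E.Nonempty) (hEM : E ⊆ Ma a) (hEb : BoundedA a E)
    (p : ℕ → ℝ) (hp : p ∈ E) (r : ℝ) (hr : 0 < r)
    (hEr : ∀ x ∈ E, da a x p < r) :
    GS a (GS a E p ∩ {y | y ∈ Ma a ∧ da a y p < r}) p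
      = {x | x ∈ Ma a ∧ ∀ ε > 0, ∃ y ∈ GS a E p, da a x y < ε} := by
  have hpa := hEM hp
  have hGS : ∀ y ∈ GS a E p, y - p ∈ maClosure a (dirSpan E p) := fun y hy =>
    sub_mem_maClosure_of_mem_GS hpa (fun x hx =>
      ⟨(maSubmodule a).sub_mem (hEM hx) hpa, fun ε hε => ⟨x - p, sub_mem_dirSpan hx,
        (maSubmodule a).sub_mem (hEM hx) hpa, by rwa [da_self]⟩⟩) hy
  ext x
  constructor
  · intro hx
    refine ⟨hx.1, fun ε hε => ?_⟩
    obtain ⟨-, h⟩ := sub_mem_maClosure_of_mem_GS hpa (fun y hy => hGS y hy.1) hx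
    obtain ⟨w, hw, -, hd⟩ := h ε hε
    refine ⟨p + w, add_mem_GS_of_mem_dirSpan hEM hp hw, ?_⟩
    rwa [da_eq_da_sub_zero, ← sub_sub, ← da_eq_da_sub_zero]
  · rintro ⟨hxa, hx⟩
    refine mem_GS_of_sub_mem_maClosure (V := dirSpan E p) hxa (fun v hv => ?_) ?_
    · obtain ⟨c, hc, hcr⟩ := exists_smul_da_lt a v hr
      have hmem := add_mem_GS_of_mem_dirSpan hEM hp ((dirSpan E p).smul_mem c hv)
      refine ⟨c, hc, hmem, hmem.1, ?_⟩
      rwa [da_eq_da_sub_zero, add_sub_cancel_left]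
    · refine mem_maClosure_of_forall_near ((maSubmodule a).sub_mem hxa hpa) fun ε hε => ?_
      obtain ⟨y, hy, hd⟩ := hx ε hε
      refine ⟨y - p, hGS y hy, ?_⟩
      rwa [da_eq_da_sub_zero, sub_sub_sub_cancel_right, ← da_eq_da_sub_zero]
end
end

section
/- For every basic cylinder J, μ(∂J) = 0, where ∂J denotes the boundary of J taken in the topological subspace I^ω (with the topology induced by d_a). -/
open Filter

noncomputable section

theorem summable_sq_mul_sub_sq {a x y : ℕ → ℝ} (hsum : Summable fun i => (a i) ^ 2)
    (hx : x ∈ cube) (hy : y ∈ cube) : Summable fun i => (a i) ^ 2 * (x i - y i) ^ 2 := by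
  refine Summable.of_nonneg_of_le (fun i => by positivity) (fun i => ?_) hsum
  have h : (x i - y i) ^ 2 ≤ 1 := by
    rw [sq_le_one_iff_abs_le_one, abs_le]
    obtain ⟨h1, h2⟩ := hx i
    obtain ⟨h3, h4⟩ := hy i
    constructor <;> linarith
  exact mul_le_of_le_one_right (sq_nonneg _) h

theorem mul_abs_sub_le_da {a x y : ℕ → ℝ}
    (hsum : Summable fun i => (a i) ^ 2) (hx : x ∈ cube) (hy : y ∈ cube) (i : ℕ) :
    a i * |x i - y i| ≤ da a x y := by
  refine Real.le_sqrt_of_sq_le ?_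
  rw [mul_pow, sq_abs]
  exact (summable_sq_mul_sub_sq hsum hx hy).le_tsum i fun j _ => by positivity

theorem cylSet_subset_cube {lo hi : ℕ → ℝ} (hJ : IsBCData lo hi) : cylSet lo hi ⊆ cube :=
  fun _ hx i => ⟨(hJ.1 i).trans (hx i).1, (hx i).2.trans (hJ.2.2.1 i)⟩

/-- A boundary point of a basic cylinder lies on one of its faces. -/
theorem exists_eq_lo_or_eq_hi_of_mem_boundary {a x lo hi : ℕ → ℝ} (ha : ∀ i, 0 < a i)
    (hsum : Summable fun i => (a i) ^ 2) (hJ : IsBCData lo hi) (hx : x ∈ cube)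
    (hin : ∀ ε > 0, ∃ y ∈ cylSet lo hi, da a x y < ε)
    (hout : ∀ ε > 0, ∃ y ∈ cube \ cylSet lo hi, da a x y < ε) :
    ∃ i, x i = lo i ∨ x i = hi i := by
  by_contra! hne
  have hmem : ∀ i, lo i < x i ∧ x i < hi i := by
    intro i
    by_contra hcon
    have hgap : 0 < max (lo i - x i) (x i - hi i) := by
      rw [lt_max_iff]
      by_contra! h
      exact hcon ⟨lt_of_le_of_ne (by linarith) (hne i).1.symm,
        lt_of_le_of_ne (by linarith) (hne i).2⟩
    obtain ⟨y, hy, hlt⟩ := hin _ (mul_pos (ha i) hgap)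
    have h := (mul_abs_sub_le_da hsum hx (cylSet_subset_cube hJ hy) i).trans_lt hlt
    have h' := lt_of_mul_lt_mul_left h (ha i).le
    obtain ⟨h1, h2⟩ := hy i
    have h3 := le_abs_self (x i - y i)
    have h4 := neg_abs_le (x i - y i)
    rcases lt_max_iff.1 h' with h5 | h5 <;> linarith
  have hev : ∀ᶠ ε in nhdsWithin (0 : ℝ) (Set.Ioi 0), ∀ i ∈ {i | ¬(lo i = 0 ∧ hi i = 1)},
      ε < a i * min (x i - lo i) (hi i - x i) := by
    rw [eventually_all_finite hJ.2.2.2]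
    intro i _
    refine mem_nhdsWithin_of_mem_nhds (Iio_mem_nhds (mul_pos (ha i) (lt_min ?_ ?_)))
    · linarith [(hmem i).1]
    · linarith [(hmem i).2]
  obtain ⟨ε, hε, hε0⟩ := (hev.and self_mem_nhdsWithin).exists
  obtain ⟨y, ⟨hyc, hyn⟩, hlt⟩ := hout ε hε0
  refine hyn fun i => ?_
  by_cases hi' : lo i = 0 ∧ hi i = 1
  · rw [hi'.1, hi'.2]
    exact hyc i
  · have h := ((mul_abs_sub_le_da hsum hx hyc i).trans_lt hlt).trans (hε i hi')
    have h' := lt_min_iff.1 (lt_of_mul_lt_mul_left h (ha i).le)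
    have h3 := le_abs_self (x i - y i)
    have h4 := neg_abs_le (x i - y i)
    constructor <;> linarith [h'.1, h'.2]

/-- Edge lengths bounding those of the `n`-th grid: `1 / (n + 1)` in the coordinates `≤ n`. -/
def gridWidth (n j : ℕ) : ℝ := if j < n + 1 then 1 / ((n : ℝ) + 1) else 1

theorem gridWidth_nonneg (n j : ℕ) : 0 ≤ gridWidth n j := by
  unfold gridWidth
  split_ifs <;> positivity

theorem gridWidth_le_one (n j : ℕ) : gridWidth n j ≤ 1 := by
  unfold gridWidth
  split_ifs
  · rw [div_le_one (by positivity)]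
    linarith [(Nat.cast_nonneg n : (0 : ℝ) ≤ n)]
  · exact le_rfl

theorem tendsto_tsum_sq_mul_gridWidth_sq {a : ℕ → ℝ} (hsum : Summable fun i => (a i) ^ 2) :
    Tendsto (fun n => ∑' j, (a j) ^ 2 * gridWidth n j ^ 2) atTop (nhds 0) := by
  have h : Tendsto (fun n => ∑' j, (a j) ^ 2 * gridWidth n j ^ 2) atTop
      (nhds (∑' _ : ℕ, (0 : ℝ))) := by
    refine tendsto_tsum_of_dominated_convergence hsum (fun j => ?_)
      (Eventually.of_forall fun n j => ?_)
    · have hw : Tendsto (fun n => gridWidth n j) atTop (nhds 0) := by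
        refine tendsto_one_div_add_atTop_nhds_zero_nat.congr' ?_
        filter_upwards [eventually_ge_atTop j] with n hn
        rw [gridWidth, if_pos (by omega)]
      simpa using (hw.pow 2).const_mul ((a j) ^ 2)
    · rw [Real.norm_of_nonneg (by positivity)]
      exact mul_le_of_le_one_right (sq_nonneg _)
        (pow_le_one₀ (gridWidth_nonneg n j) (gridWidth_le_one n j))
  simpa using h

theorem daDiam_cylSet_le {a lo hi : ℕ → ℝ} {n : ℕ} (hsum : Summable fun i => (a i) ^ 2)
    (hJ : IsBCData lo hi) (hw : ∀ j, hi j - lo j ≤ gridWidth n j) :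
    daDiam a (cylSet lo hi) ≤ Real.sqrt (∑' j, (a j) ^ 2 * gridWidth n j ^ 2) := by
  refine Real.sSup_le ?_ (Real.sqrt_nonneg _)
  rintro _ ⟨x, hx, y, hy, rfl⟩
  refine Real.sqrt_le_sqrt (Summable.tsum_le_tsum (fun j => ?_)
    (summable_sq_mul_sub_sq hsum (cylSet_subset_cube hJ hx) (cylSet_subset_cube hJ hy)) ?_)
  · refine mul_le_mul_of_nonneg_left (sq_le_sq' ?_ ?_) (sq_nonneg _) <;>
      linarith [(hx j).1, (hx j).2, (hy j).1, (hy j).2, hw j]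
  · refine Summable.of_nonneg_of_le (fun j => by positivity) (fun j => ?_) hsum
    exact mul_le_of_le_one_right (sq_nonneg _)
      (pow_le_one₀ (gridWidth_nonneg n j) (gridWidth_le_one n j))

theorem bcVol_eq_zero {lo hi : ℕ → ℝ} (hJ : IsBCData lo hi) {i : ℕ} (h : lo i = hi i) :
    bcVol lo hi = 0 := by
  refine finprod_eq_zero (fun j => hi j - lo j) i (by simp [h]) (hJ.2.2.2.subset fun j hj => ?_)
  rintro ⟨h0, h1⟩
  exact hj (by simp [h0, h1])

/-- Lower endpoints of the cell `g` of the `n`-th grid of the face `{x | x i = c}`. -/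
def cellLo (n i : ℕ) (c : ℝ) (g : Fin (n + 1) → Fin (n + 1)) (j : ℕ) : ℝ :=
  if j = i then c else if h : j < n + 1 then (g ⟨j, h⟩ : ℝ) / ((n : ℝ) + 1) else 0

/-- Upper endpoints of the cell `g` of the `n`-th grid of the face `{x | x i = c}`. -/
def cellHi (n i : ℕ) (c : ℝ) (g : Fin (n + 1) → Fin (n + 1)) (j : ℕ) : ℝ :=
  if j = i then c else if h : j < n + 1 then ((g ⟨j, h⟩ : ℝ) + 1) / ((n : ℝ) + 1) else 1

theorem isBCData_cell (n i : ℕ) {c : ℝ} (hc : c ∈ Set.Icc (0 : ℝ) 1)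
    (g : Fin (n + 1) → Fin (n + 1)) : IsBCData (cellLo n i c g) (cellHi n i c g) := by
  refine ⟨fun j => ?_, fun j => ?_, fun j => ?_, ?_⟩
  · unfold cellLo
    split_ifs
    · exact hc.1
    · positivity
    · exact le_rfl
  · unfold cellLo cellHi
    split_ifs
    · exact le_rfl
    · gcongr
      linarith
    · exact zero_le_one
  · unfold cellHi
    split_ifs with _ h
    · exact hc.2
    · rw [div_le_one (by positivity)]
      exact_mod_cast (g ⟨j, h⟩).2
    · exact le_rfl
  · refine ((Set.finite_Iio (n + 1)).insert i).subset fun j hj => ?_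
    by_contra hcon
    simp only [Set.mem_insert_iff, Set.mem_Iio, not_or] at hcon
    exact hj (by simp [cellLo, cellHi, hcon.1, hcon.2])

theorem cellHi_sub_cellLo_le (n i : ℕ) (c : ℝ) (g : Fin (n + 1) → Fin (n + 1)) (j : ℕ) :
    cellHi n i c g j - cellLo n i c g j ≤ gridWidth n j := by
  by_cases hji : j = i
  · simpa [cellLo, cellHi, hji] using gridWidth_nonneg n i
  · by_cases h : j < n + 1
    · simp only [cellLo, cellHi, gridWidth, if_neg hji, dif_pos h, if_pos h]
      rw [← sub_div, add_sub_cancel_left]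
    · simp [cellLo, cellHi, gridWidth, hji, h]

theorem exists_fin_div_le_le_div (n : ℕ) {t : ℝ} (ht : t ∈ Set.Icc (0 : ℝ) 1) :
    ∃ k : Fin (n + 1), t ∈ Set.Icc ((k : ℝ) / ((n : ℝ) + 1)) (((k : ℝ) + 1) / ((n : ℝ) + 1)) := by
  have hn : (0 : ℝ) < (n : ℝ) + 1 := by positivity
  rcases ht.2.eq_or_lt with rfl | h1
  · refine ⟨Fin.last n, ?_, ?_⟩
    · rw [div_le_one hn, Fin.val_last]
      linarith
    · rw [Fin.val_last, div_self hn.ne']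
  · have h0 : 0 ≤ t * ((n : ℝ) + 1) := mul_nonneg ht.1 hn.le
    refine ⟨⟨⌊t * ((n : ℝ) + 1)⌋₊, ?_⟩, ?_, ?_⟩
    · rw [Nat.floor_lt h0]
      push_cast
      nlinarith
    · rw [div_le_iff₀ hn]
      exact Nat.floor_le h0
    · rw [le_div_iff₀ hn]
      exact (Nat.lt_floor_add_one _).le

theorem exists_mem_cell (n i : ℕ) {x : ℕ → ℝ} (hx : x ∈ cube) :
    ∃ g, x ∈ cylSet (cellLo n i (x i) g) (cellHi n i (x i) g) := by
  choose g hg using fun j : Fin (n + 1) => exists_fin_div_le_le_div n (hx j)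
  refine ⟨g, fun j => ?_⟩
  by_cases hji : j = i
  · simp [cellLo, cellHi, hji]
  · by_cases h : j < n + 1
    · simpa only [cellLo, cellHi, if_neg hji, dif_pos h] using hg ⟨j, h⟩
    · simpa [cellLo, cellHi, hji, h] using hx j

/-- For every basic cylinder `J`, `μ(∂J) = 0`, where `∂J` is the boundary of `J`
in the metric subspace `I^ω` of `(M_a, d_a)`. -/
theorem ulam_stmt14 (a : ℕ → ℝ) (ha : ∀ i, 0 < a i)
    (hsum : Summable fun i => (a i) ^ 2)
    (lo hi : ℕ → ℝ) (hJ : IsBCData lo hi) :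
    muA a {x | x ∈ cube ∧
      (∀ ε > 0, ∃ y ∈ cylSet lo hi, da a x y < ε) ∧
      (∀ ε > 0, ∃ y ∈ cube \ cylSet lo hi, da a x y < ε)} = 0 := by
  simp only [muA, ENNReal.iSup_eq_zero]
  intro δ hδ
  obtain ⟨n, hn⟩ := ((tendsto_tsum_sq_mul_gridWidth_sq hsum).eventually_lt_const
    (show (0 : ℝ) < δ ^ 2 by positivity)).exists
  let c : ℕ × Bool → ℝ := fun p => cond p.2 (hi p.1) (lo p.1)
  have hc : ∀ p, c p ∈ Set.Icc (0 : ℝ) 1 := by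
    rintro ⟨i, _ | _⟩
    · exact ⟨hJ.1 i, (hJ.2.1 i).trans (hJ.2.2.1 i)⟩
    · exact ⟨(hJ.1 i).trans (hJ.2.1 i), hJ.2.2.1 i⟩
  obtain ⟨e, he⟩ :=
    exists_surjective_nat ((ℕ × Bool) × (Fin (n + 1) → Fin (n + 1)))
  have hcell : ∀ k, IsBCData (cellLo n (e k).1.1 (c (e k).1) (e k).2)
      (cellHi n (e k).1.1 (c (e k).1) (e k).2) := fun k => isBCData_cell n _ (hc _) _
  refine le_antisymm (sInf_le ⟨fun k => cylSet (cellLo n (e k).1.1 (c (e k).1) (e k).2)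
    (cellHi n (e k).1.1 (c (e k).1) (e k).2), fun _ => 0, fun k => ?_, fun k => ?_, ?_, by simp⟩)
    bot_le
  · exact ⟨_, _, hcell k, (bcVol_eq_zero (hcell k) (i := (e k).1.1) (by simp [cellLo, cellHi])).symm,
      id, fun _ _ _ _ => rfl, Set.image_id _⟩
  · refine (daDiam_cylSet_le hsum (hcell k) (cellHi_sub_cellLo_le n _ _ _)).trans_lt ?_
    exact (Real.sqrt_lt' hδ).2 hn
  · rintro x ⟨hx, hin, hout⟩
    obtain ⟨i, hxi⟩ := exists_eq_lo_or_eq_hi_of_mem_boundary ha hsum hJ hx hin hout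
    obtain ⟨g, hg⟩ := exists_mem_cell n i hx
    obtain ⟨b, hb⟩ : ∃ b, c (i, b) = x i :=
      hxi.elim (fun h => ⟨false, h.symm⟩) fun h => ⟨true, h.symm⟩
    obtain ⟨k, hk⟩ := he ((i, b), g)
    refine Set.mem_iUnion.2 ⟨k, ?_⟩
    simpa only [hk, hb] using hg
end
end
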